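/- arXiv:2108.02134 — 6 statements merged into one kernel-verified Lean document; each statement's English description precedes it below -/
import Mathlib

section
/- Let X and Y be compact metric spaces and let f_k : X → Y for k ∈ ℕ ∪ {∞} be functions all defined on the full space X. Then f_k converges invariably to f_∞ if and only if f_k converges uniformly to f_∞ and f_∞ is continuous. -/
open Metric Filter

/-- Invariable convergence of a sequence of functions `f k : A k → Y` (modelled as functions on
all of `X`, with only their values on `A k` constrained) to `flim : Alim → Y`:
the domains converge in Hausdorff distance, and for every `ε > 0` there are `K` and `δ > 0`
such that for all `k ≥ K`, `x ∈ A k`, `x' ∈ Alim` with `dist x x' < δ` we have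
`dist (f k x) (flim x') < ε`. -/
def InvariablyTendsto {X Y : Type*} [MetricSpace X] [MetricSpace Y]
    (A : ℕ → Set X) (Alim : Set X) (f : ℕ → X → Y) (flim : X → Y) : Prop :=
  Tendsto (fun k => Metric.hausdorffDist (A k) Alim) atTop (nhds 0) ∧
  ∀ ε > (0 : ℝ), ∃ K : ℕ, ∃ δ > (0 : ℝ), ∀ k ≥ K, ∀ x ∈ A k, ∀ x' ∈ Alim,
    dist x x' < δ → dist (f k x) (flim x') < ε

/-- For functions defined on all of a compact metric space `X`, invariable convergence is
equivalent to uniform convergence together with continuity of the limit. -/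
theorem invariablyTendsto_univ_iff {X Y : Type*} [MetricSpace X] [MetricSpace Y]
    [CompactSpace X] [CompactSpace Y] (f : ℕ → X → Y) (flim : X → Y) :
    InvariablyTendsto (fun _ => Set.univ) Set.univ f flim ↔
      TendstoUniformly f flim atTop ∧ Continuous flim := by
  constructor
  · rintro ⟨-, h⟩
    constructor
    · rw [Metric.tendstoUniformly_iff]
      intro ε hε
      obtain ⟨K, δ, hδ, H⟩ := h ε hε
      filter_upwards [eventually_ge_atTop K] with k hk x
      rw [dist_comm]
      exact H k hk x (Set.mem_univ _) x (Set.mem_univ _) (by simpa using hδ)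
    · rw [Metric.continuous_iff]
      intro b ε hε
      obtain ⟨K, δ, hδ, H⟩ := h (ε / 2) (half_pos hε)
      refine ⟨δ, hδ, fun a hab => ?_⟩
      have h1 := H K le_rfl a (Set.mem_univ _) a (Set.mem_univ _) (by simpa using hδ)
      have h2 := H K le_rfl a (Set.mem_univ _) b (Set.mem_univ _) hab
      have h3 := dist_triangle_left (flim a) (flim b) (f K a)
      linarith
  · rintro ⟨hu, hc⟩
    refine ⟨by simp, fun ε hε => ?_⟩
    have hc' := CompactSpace.uniformContinuous_of_continuous hc
    obtain ⟨δ, hδ, H⟩ := Metric.uniformContinuous_iff.1 hc' (ε / 2) (half_pos hε)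
    obtain ⟨K, hK⟩ := eventually_atTop.1 (Metric.tendstoUniformly_iff.1 hu (ε / 2) (half_pos hε))
    refine ⟨K, δ, hδ, fun k hk x _ x' _ hx => ?_⟩
    have h1 := hK k hk x
    have h2 := H hx
    have h3 := dist_triangle_left (f k x) (flim x') (flim x)
    linarith
end

section
/- Let X and Y be compact metric spaces, let X_k ⊆ X for k ∈ ℕ ∪ {∞}, and let f_k : X_k → Y be continuous injective maps (hence homeomorphic embeddings of the compact sets X_k into Y). If f_k converges invariably to f_∞, then the inverse maps f_k⁻¹ : f_k(X_k) → X_k converge invariably to f_∞⁻¹ : f_∞(X_∞) → X_∞. -/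
open Metric Filter

/-- If continuous injective maps `f k : A k → Y` (homeomorphic embeddings of the compact sets
`A k` into `Y`) converge invariably to `flim : Alim → Y`, then the inverse maps
`(f k)⁻¹ : f k '' A k → A k` converge invariably to `flim⁻¹ : flim '' Alim → Alim`. -/
theorem invariablyTendsto_inverse {X Y : Type*} [MetricSpace X] [MetricSpace Y]
    [CompactSpace X] [CompactSpace Y] [Nonempty X]
    (A : ℕ → Set X) (Alim : Set X)
    (hA : ∀ k, IsCompact (A k)) (hAlim : IsCompact Alim)
    (f : ℕ → X → Y) (flim : X → Y)
    (hfc : ∀ k, ContinuousOn (f k) (A k)) (hfi : ∀ k, Set.InjOn (f k) (A k))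
    (hlimc : ContinuousOn flim Alim) (hlimi : Set.InjOn flim Alim)
    (h : InvariablyTendsto A Alim f flim) :
    InvariablyTendsto (fun k => f k '' A k) (flim '' Alim)
      (fun k => Function.invFunOn (f k) (A k)) (Function.invFunOn flim Alim) := by
  obtain ⟨hH, hC⟩ := h
  have hev : ∀ r > (0 : ℝ), ∃ K : ℕ, ∀ k ≥ K, Metric.hausdorffDist (A k) Alim < r := by
    intro r hr
    exact eventually_atTop.1 (hH.eventually (gt_mem_nhds hr))
  have hfin : ∀ k, (A k).Nonempty → Alim.Nonempty →
      Metric.hausdorffEDist (A k) Alim ≠ ⊤ := fun k h1 h2 =>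
    Metric.hausdorffEDist_ne_top_of_nonempty_of_bounded h1 h2 (hA k).isBounded hAlim.isBounded
  refine ⟨?_, ?_⟩
  · rw [Metric.tendsto_atTop]
    intro ε hε
    obtain ⟨K, δ, hδ, hK⟩ := hC (ε / 2) (by positivity)
    obtain ⟨K', hK'⟩ := hev δ hδ
    refine ⟨max K K', fun k hk => ?_⟩
    have hk1 : K ≤ k := le_trans (le_max_left _ _) hk
    have hk2 : K' ≤ k := le_trans (le_max_right _ _) hk
    rw [Real.dist_eq, sub_zero, abs_of_nonneg Metric.hausdorffDist_nonneg]
    rcases (A k).eq_empty_or_nonempty with h1 | h1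
    · simpa [h1] using hε
    rcases Alim.eq_empty_or_nonempty with h2 | h2
    · simpa [h2] using hε
    refine lt_of_le_of_lt (b := ε / 2) ?_ (by linarith)
    refine Metric.hausdorffDist_le_of_mem_dist (by positivity) ?_ ?_
    · rintro _ ⟨x, hx, rfl⟩
      obtain ⟨z, hz, hxz⟩ := Metric.exists_dist_lt_of_hausdorffDist_lt hx (hK' k hk2) (hfin k h1 h2)
      exact ⟨_, ⟨z, hz, rfl⟩, (hK k hk1 x hx z hz hxz).le⟩
    · rintro _ ⟨z, hz, rfl⟩
      obtain ⟨x, hx, hxz⟩ := Metric.exists_dist_lt_of_hausdorffDist_lt' hz (hK' k hk2) (hfin k h1 h2)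
      refine ⟨_, ⟨x, hx, rfl⟩, ?_⟩
      rw [dist_comm]
      exact (hK k hk1 x hx z hz hxz).le
  · intro ε hε
    have hη : ∃ η > (0 : ℝ), ∀ a ∈ Alim, ∀ b ∈ Alim,
        dist (flim a) (flim b) < η → dist a b < ε / 2 := by
      have hS : IsCompact ((Alim ×ˢ Alim) ∩ {p : X × X | ε / 2 ≤ dist p.1 p.2}) :=
        (hAlim.prod hAlim).inter_right (isClosed_le continuous_const continuous_dist)
      have hcont : ContinuousOn (fun p : X × X => dist (flim p.1) (flim p.2))
          ((Alim ×ˢ Alim) ∩ {p : X × X | ε / 2 ≤ dist p.1 p.2}) := by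
        refine continuous_dist.comp_continuousOn (ContinuousOn.prodMk ?_ ?_)
        · exact hlimc.comp continuousOn_fst fun p hp => hp.1.1
        · exact hlimc.comp continuousOn_snd fun p hp => hp.1.2
      rcases Set.eq_empty_or_nonempty
        ((Alim ×ˢ Alim) ∩ {p : X × X | ε / 2 ≤ dist p.1 p.2}) with he | hne
      · refine ⟨1, one_pos, fun a ha b hb _ => ?_⟩
        by_contra hc
        have : (a, b) ∈ ((Alim ×ˢ Alim) ∩ {p : X × X | ε / 2 ≤ dist p.1 p.2}) :=
          ⟨⟨ha, hb⟩, not_lt.1 hc⟩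
        rw [he] at this
        exact this
      · obtain ⟨p, hp, hmin⟩ := hS.exists_isMinOn hne hcont
        refine ⟨dist (flim p.1) (flim p.2), ?_, fun a ha b hb hab => ?_⟩
        · refine dist_pos.2 fun heq => ?_
          have h1 := hlimi hp.1.1 hp.1.2 heq
          have h2 : ε / 2 ≤ dist p.1 p.2 := hp.2
          rw [h1, dist_self] at h2
          linarith
        · by_contra hc
          have h1 : dist (flim p.1) (flim p.2) ≤ dist (flim a) (flim b) :=
            hmin (a := (a, b)) ⟨⟨ha, hb⟩, not_lt.1 hc⟩
          linarith
    obtain ⟨η, hη0, hη⟩ := hη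
    obtain ⟨K, δ, hδ, hK⟩ := hC (η / 2) (by positivity)
    obtain ⟨K', hK'⟩ := hev (min δ (ε / 2)) (lt_min hδ (by positivity))
    refine ⟨max K K', η / 2, by positivity, fun k hk => ?_⟩
    have hk1 : K ≤ k := le_trans (le_max_left _ _) hk
    have hk2 : K' ≤ k := le_trans (le_max_right _ _) hk
    rintro _ ⟨x, hx, rfl⟩ _ ⟨x', hx', rfl⟩ hd
    show dist (Function.invFunOn (f k) (A k) (f k x)) (Function.invFunOn flim Alim (flim x')) < ε
    rw [(hfi k).leftInvOn_invFunOn hx, hlimi.leftInvOn_invFunOn hx']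
    obtain ⟨z, hz, hxz⟩ := Metric.exists_dist_lt_of_hausdorffDist_lt hx (hK' k hk2)
      (hfin k ⟨x, hx⟩ ⟨x', hx'⟩)
    have h1 := hK k hk1 x hx z hz (lt_of_lt_of_le hxz (min_le_left _ _))
    have h2 := lt_of_lt_of_le hxz (min_le_right _ _)
    have h3 := hη z hz x' hx' (by
      have := dist_triangle_left (flim z) (flim x') (f k x)
      linarith)
    have := dist_triangle x z x'
    linarith
end

section
/- Let X, Y, Z be compact metric spaces, let X_k ⊆ X and Y_k ⊆ Y for k ∈ ℕ ∪ {∞}, and let f_k : X_k → Y_k and g_k : Y_k → Z be functions. If f_k converges invariably to f_∞ and g_k converges invariably to g_∞, then the compositions g_k ∘ f_k : X_k → Z converge invariably to g_∞ ∘ f_∞. -/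
open Metric Filter

/-- If `f k : A k → B k` converges invariably to `flim` and `g k : B k → Z` converges invariably
to `glim`, then `g k ∘ f k : A k → Z` converges invariably to `glim ∘ flim`. -/
theorem invariablyTendsto_comp {X Y Z : Type*}
    [MetricSpace X] [MetricSpace Y] [MetricSpace Z]
    [CompactSpace X] [CompactSpace Y] [CompactSpace Z]
    (A : ℕ → Set X) (Alim : Set X) (B : ℕ → Set Y) (Blim : Set Y)
    (f : ℕ → X → Y) (flim : X → Y) (g : ℕ → Y → Z) (glim : Y → Z)
    (hmaps : ∀ k, Set.MapsTo (f k) (A k) (B k)) (hmapslim : Set.MapsTo flim Alim Blim)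
    (hf : InvariablyTendsto A Alim f flim) (hg : InvariablyTendsto B Blim g glim) :
    InvariablyTendsto A Alim (fun k => g k ∘ f k) (glim ∘ flim) := by
  refine ⟨hf.1, fun ε hε => ?_⟩
  obtain ⟨K₁, δ₁, hδ₁, h₁⟩ := hg.2 ε hε
  obtain ⟨K₂, δ₂, hδ₂, h₂⟩ := hf.2 δ₁ hδ₁
  refine ⟨max K₁ K₂, δ₂, hδ₂, fun k hk x hx x' hx' hd => ?_⟩
  exact h₁ k (le_trans (le_max_left _ _) hk) _ (hmaps k hx) _ (hmapslim hx')
    (h₂ k (le_trans (le_max_right _ _) hk) x hx x' hx' hd)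
end

section
/- Let u₁, u₂, u₋₁, u₋₂ be four distinct points on the unit circle S¹ ⊆ ℂ in counterclockwise order. Then there exists a unique conformal automorphism f of the closed unit disc such that f(u₁) = 1, f(u₋₁) = -1, and f(u₋₂) = -f(u₂). Moreover, f depends continuously on (u₁, u₂, u₋₁, u₋₂) in the sup metric on maps of the closed disc. -/
noncomputable section

/-- The closed unit disc in `ℂ`. -/
def unitDisc : Set ℂ := Metric.closedBall 0 1

/-- A conformal automorphism of the closed unit disc: a homeomorphism of the closed disc onto
itself (equivalently, since the disc is compact Hausdorff, a continuous bijection of the disc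
onto itself) whose restriction to the open unit disc is holomorphic. -/
def IsConfAut (f : ℂ → ℂ) : Prop :=
  ContinuousOn f unitDisc ∧ Set.BijOn f unitDisc unitDisc ∧
    DifferentiableOn ℂ f (Metric.ball 0 1)

/-- Four points of the unit circle in counterclockwise order. -/
def CCW4 (u₁ u₂ u₃ u₄ : ℂ) : Prop :=
  ∃ θ₁ θ₂ θ₃ θ₄ : ℝ, θ₁ < θ₂ ∧ θ₂ < θ₃ ∧ θ₃ < θ₄ ∧ θ₄ < θ₁ + 2 * Real.pi ∧
    u₁ = Complex.exp (θ₁ * Complex.I) ∧ u₂ = Complex.exp (θ₂ * Complex.I) ∧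
    u₃ = Complex.exp (θ₃ * Complex.I) ∧ u₄ = Complex.exp (θ₄ * Complex.I)

open Complex ComplexConjugate
theorem mob_id (T p q z : ℂ) (t : ℝ) (hp : normSq p = 1) (h : conj T * p = T * q) :
   normSq (T*(z-q) - I*t*(z-p)) - normSq (T*(z-q) + I*t*(z-p)) = 4*t*T.im*(1-normSq z) := by
  have h1 := congrArg re h
  have h2 := congrArg im h
  simp [normSq_apply] at *
  linear_combination (4*t*(z.im-p.im)) * h1 - 4*t*(z.re-p.re)*h2 + 4*t*T.im*hp

theorem sin3 (a b : ℝ) (ha : 0 < a) (hb : 0 < b) (hab : a + b < 2*Real.pi) :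
   0 < Real.sin a + Real.sin b - Real.sin (a+b) := by
  have e1 : 0 < Real.sin (a/2) := Real.sin_pos_of_pos_of_lt_pi (by linarith) (by linarith)
  have e2 : 0 < Real.sin (b/2) := Real.sin_pos_of_pos_of_lt_pi (by linarith) (by linarith)
  have e3 : 0 < Real.sin (a/2+b/2) := Real.sin_pos_of_pos_of_lt_pi (by linarith) (by linarith)
  have : Real.sin a + Real.sin b - Real.sin (a+b) = 4 * Real.sin (a/2) * Real.sin (b/2) * Real.sin (a/2+b/2) := by
    have ha2 : a = 2*(a/2) := by ring
    have hb2 : b = 2*(b/2) := by ring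
    generalize a/2 = x at *
    generalize b/2 = y at *
    subst ha2 hb2
    rw [← mul_add, Real.sin_two_mul, Real.sin_two_mul, Real.sin_two_mul, Real.sin_add, Real.cos_add]
    have hx := Real.sin_sq_add_cos_sq x
    have hy := Real.sin_sq_add_cos_sq y
    grind
  rw [this]; positivity

theorem im_T (x y z : ℝ) :
  ((exp (y*I) - exp (x*I)) * conj (exp (y*I) - exp (z*I))).im = Real.sin (y-x) + Real.sin (z-y) - Real.sin (z-x) := by
  simp [exp_re, exp_im, Real.sin_sub]
  ring
theorem conj_T (p q r : ℂ) (hp : ‖p‖=1) (hq : ‖q‖=1) (hr : ‖r‖=1) :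
   conj ((r-p)/(r-q)) * p = ((r-p)/(r-q)) * q := by
  have a1 : p ≠ 0 := by rintro rfl; simp at hp
  have a2 : q ≠ 0 := by rintro rfl; simp at hq
  have a3 : r ≠ 0 := by rintro rfl; simp at hr
  by_cases h : r = q
  · simp [h]
  have b1 : r - q ≠ 0 := sub_ne_zero.2 h
  have b2 : q - r ≠ 0 := sub_ne_zero.2 (Ne.symm h)
  rw [map_div₀, map_sub, map_sub, ← inv_eq_conj hp, ← inv_eq_conj hq, ← inv_eq_conj hr]
  rw [inv_sub_inv a3 a1, inv_sub_inv a3 a2]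
  field_simp
  ring
theorem im_div_eq (a b : ℂ) : (a/b).im = (a * conj b).im / normSq b := by
  rw [div_im]; simp; ring
theorem im_T1 (x y z : ℝ) (h1 : x < y) (h2 : y < z) (h3 : z < x + 2*Real.pi) :
   0 < ((exp (y*I) - exp (x*I)) / (exp (y*I) - exp (z*I))).im := by
  rw [im_div_eq, im_T]
  have h := sin3 (y-x) (z-y) (by linarith) (by linarith) (by linarith)
  rw [show y - x + (z-y) = z - x by ring] at h
  apply div_pos h
  rw [normSq_pos]
  intro h0
  rw [← im_T, h0] at h
  simp at h
theorem im_T2 (x y z : ℝ) (h1 : x < z) (h2 : z < y) (h3 : y < x + 2*Real.pi) :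
   ((exp (y*I) - exp (x*I)) / (exp (y*I) - exp (z*I))).im < 0 := by
  have h := im_T1 x z y h1 h2 h3
  have h' := sin3 (z-x) (y-z) (by linarith) (by linarith) (by linarith)
  rw [im_div_eq, im_T]
  rw [show z - x + (y-z) = y - x by ring] at h'
  have : Real.sin (z-y) = - Real.sin (y-z) := by rw [← Real.sin_neg]; ring_nf
  apply div_neg_of_neg_of_pos (by linarith)
  rw [normSq_pos]
  intro h0
  rw [← neg_sub, neg_eq_zero] at h0
  simp [h0] at h

theorem confAut_ball {h : ℂ → ℂ} (hh : IsConfAut h) {s : ℂ} (hs : ‖s‖ < 1) : ‖h s‖ < 1 := by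
  obtain ⟨hc, hb, hd⟩ := hh
  have hsD : s ∈ unitDisc := by simp [unitDisc, hs.le]
  have hle := hb.mapsTo hsD
  simp only [unitDisc, Metric.mem_closedBall, dist_zero_right] at hle
  refine lt_of_le_of_ne hle fun heq => ?_
  have hD : DiffContOnCl ℂ h (Metric.ball 0 1) := by
    refine ⟨hd, ?_⟩
    rwa [closure_ball _ one_ne_zero]
  have hmax : IsMaxOn (norm ∘ h) (Metric.ball 0 1) s := by
    intro z hz
    have := hb.mapsTo (Metric.ball_subset_closedBall hz)
    simp only [unitDisc, Metric.mem_closedBall, dist_zero_right] at this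
    simpa [heq] using this
  have hE := Complex.eqOn_closure_of_isPreconnected_of_isMaxOn_norm
    (convex_ball (0:ℂ) 1).isPreconnected Metric.isOpen_ball hD (by simpa using hs) hmax
  rw [closure_ball _ one_ne_zero] at hE
  have h1 : h 1 = h s := hE (by simp)
  have h2 : h (-1) = h s := hE (by simp)
  have := hb.injOn (by simp [unitDisc]) (by simp [unitDisc]) (h1.trans h2.symm)
  norm_num [Complex.ext_iff] at this

theorem confAut_circle {h : ℂ → ℂ} (hh : IsConfAut h) {q : ℂ} (hq : ‖q‖ = 1) : ‖h q‖ = 1 := by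
  obtain ⟨hc, hb, hd⟩ := id hh
  have : CompactSpace unitDisc := isCompact_iff_compactSpace.1 (isCompact_closedBall 0 1)
  let e : unitDisc ≃ unitDisc := hb.equiv h
  have he : Continuous e := (hc.mapsToRestrict hb.mapsTo)
  let H := he.homeoOfEquivCompactToT2
  have hmem : ∀ t : ℝ, exp (t * I) ∈ unitDisc := fun t => by
    simp [unitDisc, norm_exp_ofReal_mul_I]
  let κ : ℝ → ℂ := fun t => (H.symm ⟨exp (t * I), hmem t⟩ : ℂ)
  have hκc : Continuous κ := by
    refine continuous_subtype_val.comp (H.symm.continuous.comp ?_)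
    exact Continuous.subtype_mk (by fun_prop) _
  have hκ : ∀ t, h (κ t) = exp (t * I) := fun t =>
    congrArg Subtype.val (H.apply_symm_apply ⟨exp (t * I), hmem t⟩)
  have hκD : ∀ t, κ t ∈ unitDisc := fun t => (H.symm ⟨exp (t * I), hmem t⟩).2
  have hκn : ∀ t, ‖κ t‖ = 1 := by
    intro t
    have h1 := hκD t
    simp only [unitDisc, Metric.mem_closedBall, dist_zero_right] at h1
    refine le_antisymm h1 (not_lt.1 fun h2 => ?_)
    have := confAut_ball hh h2
    rw [hκ, norm_exp_ofReal_mul_I] at this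
    exact lt_irrefl _ this
  suffices ∃ t, κ t = q by
    obtain ⟨t, rfl⟩ := this
    rw [hκ, norm_exp_ofReal_mul_I]
  by_contra! hne
  have hq0 : q ≠ 0 := by rintro rfl; simp at hq
  have hn : ∀ t, ‖-κ t / q‖ = 1 := fun t => by simp [hκn, hq]
  have hsl : ∀ t, -κ t / q ∈ slitPlane := by
    intro t
    rw [mem_slitPlane_iff_arg]
    refine ⟨fun ha => hne t ?_, fun h0 => by simpa [h0] using hn t⟩
    have := norm_mul_exp_arg_mul_I (-κ t / q)
    rw [hn, ha, exp_pi_mul_I] at this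
    field_simp at this
    simpa using this.symm
  let g : ℝ → ℝ := fun t => arg (-κ t / q)
  have hg : Continuous g := continuous_iff_continuousAt.2 fun t =>
    (continuousAt_arg (hsl t)).comp (f := fun t => -κ t / q)
      (by fun_prop)
  have hinj : ∀ s t, g s = g t → exp (s * I) = exp (t * I) := by
    intro s t hst
    have h1 := norm_mul_exp_arg_mul_I (-κ s / q)
    have h2 := norm_mul_exp_arg_mul_I (-κ t / q)
    have h3 : -κ s / q = -κ t / q := by
      rw [← h1, ← h2, hn, hn]
      show _ * exp (g s * I) = _ * exp (g t * I)
      rw [hst]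
    have h4 : κ s = κ t := by
      field_simp at h3
      simpa using h3
    rw [← hκ, ← hκ, h4]
  let G : ℝ → ℝ := fun t => g t - g (t + Real.pi)
  have hG : Continuous G := by fun_prop
  have hper : exp (((0:ℝ):ℂ) * I) = exp (((Real.pi + Real.pi : ℝ):ℂ) * I) := by
    rw [show (((Real.pi + Real.pi : ℝ):ℂ) * I) = 2 * Real.pi * I by push_cast; ring]
    simp
  have hκper : κ 0 = κ (Real.pi + Real.pi) := by
    simp only [κ, hper]
  have hgper : g 0 = g (Real.pi + Real.pi) := by simp only [g, hκper]
  have hG0 : G Real.pi = - G 0 := by simp only [G, ← hgper, zero_add]; ring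
  have : ∃ t, G t = 0 := by
    have := mem_range_of_exists_le_of_exists_ge hG (c := 0)
    apply this
    · rcases le_total (G 0) 0 with h | h
      · exact ⟨_, h⟩
      · exact ⟨Real.pi, by linarith⟩
    · rcases le_total (G 0) 0 with h | h
      · exact ⟨Real.pi, by linarith⟩
      · exact ⟨_, h⟩
  obtain ⟨t, ht⟩ := this
  have := hinj t (t + Real.pi) (by simp only [G] at ht; linarith)
  push_cast at this
  rw [add_mul, exp_add, exp_pi_mul_I] at this
  have h0 := exp_ne_zero (t * I)
  apply h0
  linear_combination this / 2

theorem norm_blaschke (b w : ℂ) (hw : ‖w‖ = 1) : ‖w - b‖ = ‖1 - conj b * w‖ := by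
  have h1 : w * conj w = 1 := by rw [mul_conj, normSq_eq_norm_sq, hw]; simp
  have : ‖1 - conj b * w‖ = ‖w * conj (w - b)‖ := by
    congr 1
    rw [map_sub]; linear_combination -h1
  rw [this, norm_mul, hw, one_mul, norm_conj]

theorem one_sub_ne (b w : ℂ) (hb : ‖b‖ < 1) (hw : ‖w‖ ≤ 1) : 1 - conj b * w ≠ 0 := by
  intro h
  have : ‖conj b * w‖ = 1 := by rw [← sub_eq_zero.1 h]; simp
  rw [norm_mul, norm_conj] at this
  nlinarith [norm_nonneg b, norm_nonneg w]

theorem confAut_rigid {h : ℂ → ℂ} (hh : IsConfAut h) :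
    ∃ s b c : ℂ, ‖s‖ < 1 ∧ ‖b‖ < 1 ∧ ‖c‖ = 1 ∧ ∀ z ∈ unitDisc,
      (h z - b) * (1 - conj s * z) = c * (z - s) * (1 - conj b * h z) := by
  obtain ⟨hc, hb, hd⟩ := id hh
  have hs : ∃ s, ‖s‖ < 1 ∧ deriv h s ≠ 0 := by
    by_contra! hcon
    have hE : ∀ x ∈ Metric.ball (0:ℂ) 1, ∀ y ∈ Metric.ball (0:ℂ) 1, h x = h y := by
      intro x hx y hy
      refine Metric.isOpen_ball.is_const_of_deriv_eq_zero (convex_ball (0:ℂ) 1).isPreconnected hd ?_ hx hy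
      intro z hz
      exact hcon z (by simpa using hz)
    have h0 : (0:ℂ) ∈ Metric.ball (0:ℂ) 1 := by simp
    have h1 : (1/2:ℂ) ∈ Metric.ball (0:ℂ) 1 := by simp; norm_num
    have := hb.injOn (Metric.ball_subset_closedBall h0) (Metric.ball_subset_closedBall h1) (hE _ h0 _ h1)
    norm_num at this
  obtain ⟨s, hs, hds⟩ := hs
  have hbs := confAut_ball hh hs
  have hhn : ∀ z ∈ unitDisc, ‖h z‖ ≤ 1 := fun z hz => by
    simpa [unitDisc] using hb.mapsTo hz
  have hsD : s ∈ unitDisc := by simp [unitDisc, hs.le]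
  have hsn : Metric.ball (0:ℂ) 1 ∈ nhds s := Metric.isOpen_ball.mem_nhds (by simpa using hs)
  have hsn' : unitDisc ∈ nhds s := Filter.mem_of_superset hsn Metric.ball_subset_closedBall
  let Q : ℂ → ℂ := fun z => dslope h s z * (1 - conj s * z) / (1 - conj (h s) * h z)
  have hden : ∀ z ∈ unitDisc, 1 - conj (h s) * h z ≠ 0 := fun z hz => one_sub_ne _ _ hbs (hhn z hz)
  have hden' : ∀ z ∈ unitDisc, 1 - conj s * z ≠ 0 := fun z hz =>
    one_sub_ne _ _ hs (by simpa [unitDisc] using hz)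
  have hQ0 : ∀ z ∈ unitDisc, Q z ≠ 0 := by
    intro z hz
    refine div_ne_zero (mul_ne_zero ?_ (hden' z hz)) (hden z hz)
    by_cases hzs : z = s
    · subst hzs; simpa using hds
    · rw [dslope_of_ne _ hzs, slope_def_field]
      exact div_ne_zero (sub_ne_zero.2 fun h' => hzs (hb.injOn hz hsD h')) (sub_ne_zero.2 hzs)
  have hdsl : DifferentiableOn ℂ (dslope h s) (Metric.ball 0 1) := (differentiableOn_dslope hsn).2 hd
  have hcsl : ContinuousOn (dslope h s) unitDisc :=
    (continuousOn_dslope hsn').2 ⟨hc, hd.differentiableAt hsn⟩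
  have hsub : Metric.ball (0:ℂ) 1 ⊆ unitDisc := Metric.ball_subset_closedBall
  have hQd : DiffContOnCl ℂ Q (Metric.ball 0 1) := by
    refine ⟨DifferentiableOn.div (by fun_prop) (by fun_prop) fun z hz => hden z (hsub hz), ?_⟩
    rw [closure_ball _ one_ne_zero]
    exact ContinuousOn.div (by exact hcsl.mul (by fun_prop)) (by exact continuousOn_const.sub (continuousOn_const.mul hc)) hden
  have hQd' : DiffContOnCl ℂ (fun z => (Q z)⁻¹) (Metric.ball 0 1) := by
    refine ⟨hQd.1.inv fun z hz => hQ0 z (hsub hz), hQd.2.inv₀ ?_⟩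
    rw [closure_ball _ one_ne_zero]; exact hQ0
  have hQn : ∀ z, ‖z‖ = 1 → ‖Q z‖ = 1 := by
    intro z hz
    have hzs : z ≠ s := by rintro rfl; linarith
    have hzD : z ∈ unitDisc := by simp [unitDisc, hz]
    simp only [Q]
    rw [dslope_of_ne _ hzs, slope_def_field, norm_div, norm_mul, norm_div, norm_blaschke s z hz,
      norm_blaschke _ _ (confAut_circle hh hz)]
    have := norm_ne_zero_iff.2 (hden z hzD)
    have := norm_ne_zero_iff.2 (hden' z hzD)
    field_simp
  have hfr : frontier (Metric.ball (0:ℂ) 1) = Metric.sphere 0 1 := frontier_ball _ one_ne_zero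
  have hle1 : ∀ z ∈ unitDisc, ‖Q z‖ ≤ 1 := fun z hz =>
    Complex.norm_le_of_forall_mem_frontier_norm_le Metric.isBounded_ball hQd
      (fun w hw => (hQn w (by rw [hfr] at hw; simpa using hw)).le)
      (by rwa [closure_ball _ one_ne_zero])
  have hle2 : ∀ z ∈ unitDisc, ‖(Q z)⁻¹‖ ≤ 1 := fun z hz =>
    Complex.norm_le_of_forall_mem_frontier_norm_le Metric.isBounded_ball hQd'
      (fun w hw => by rw [norm_inv, (hQn w (by rw [hfr] at hw; simpa using hw)), inv_one])
      (by rwa [closure_ball _ one_ne_zero])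
  have hsQ : ‖Q s‖ = 1 := by
    refine le_antisymm (hle1 s hsD) ?_
    have := hle2 s hsD
    rw [norm_inv] at this
    exact (inv_le_one₀ (norm_pos_iff.2 (hQ0 s hsD))).1 this
  have hE := Complex.eqOn_closure_of_isPreconnected_of_isMaxOn_norm
    (convex_ball (0:ℂ) 1).isPreconnected Metric.isOpen_ball hQd (c := s) (by simpa using hs)
    (fun z hz => by simpa [hsQ] using hle1 z (hsub hz))
  rw [closure_ball _ one_ne_zero] at hE
  refine ⟨s, h s, Q s, hs, hbs, hsQ, fun z hz => ?_⟩
  by_cases hzs : z = s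
  · subst hzs; simp
  have hz' : Q z = Q s := hE hz
  rw [← hz']
  simp only [Q]
  rw [dslope_of_ne _ hzs, slope_def_field]
  have h1 := hden z hz
  have h2 := sub_ne_zero.2 hzs
  generalize 1 - conj (h s) * h z = d at *
  field_simp

theorem confAut_eq_id {h : ℂ → ℂ} (hh : IsConfAut h) (h1 : h 1 = 1) (h2 : h (-1) = -1) (w : ℂ)
    (hw : w ∈ unitDisc) (hw2 : w ^ 2 ≠ 1) (h3 : h (-w) = - h w) : ∀ z ∈ unitDisc, h z = z := by
  obtain ⟨s, b, c, hs, hb, hc, H⟩ := confAut_rigid hh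
  have e1 := H 1 (by simp [unitDisc])
  have e2 := H (-1) (by simp [unitDisc])
  have e3 := H w hw
  have e4 := H (-w) (by simpa [unitDisc] using hw)
  rw [h1] at e1
  rw [h2] at e2
  rw [h3] at e4
  have hα : c - b * conj s ≠ 0 := by
    intro h0
    have : ‖c‖ = ‖b * conj s‖ := by rw [sub_eq_zero.1 h0]
    rw [hc, norm_mul, norm_conj] at this
    nlinarith [norm_nonneg b, norm_nonneg s]
  obtain ⟨α, hαd⟩ : ∃ α, α = c - b * conj s := ⟨_, rfl⟩
  obtain ⟨β, hβd⟩ : ∃ β, β = b - c * s := ⟨_, rfl⟩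
  rw [← hαd] at hα
  have hγ : conj b * c - conj s = β := by rw [hβd]; linear_combination (e1 + e2)/2
  have hδ : 1 - conj b * c * s = α := by rw [hαd]; linear_combination (e1 - e2)/2
  have K : ∀ z ∈ unitDisc, h z * (β * z + α) = α * z + β := by
    intro z hz
    have := H z hz
    linear_combination this - h z * z * hγ - h z * hδ - z * hαd - hβd
  have k3 := K w hw
  have k4 := K (-w) (by simpa [unitDisc] using hw)
  rw [h3] at k4
  have hβ : β = 0 := by
    have hp : (α * (1 - w ^ 2)) * β = 0 := by
      linear_combination (-(α - β * w) * k3 - (β * w + α) * k4) / 2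
    exact (mul_eq_zero.1 hp).resolve_left (mul_ne_zero hα (sub_ne_zero.2 (Ne.symm hw2)))
  intro z hz
  have := K z hz
  rw [hβ] at this
  apply mul_right_cancel₀ hα
  linear_combination this

def mob (T p q : ℂ) (t : ℝ) (z : ℂ) : ℂ :=
  (T * (z - q) + I * t * (z - p)) / (T * (z - q) - I * t * (z - p))

def mobInv (T p q : ℂ) (t : ℝ) (w : ℂ) : ℂ :=
  (T * q * (1 - w) + I * t * p * (1 + w)) / (T * (1 - w) + I * t * (1 + w))

structure MobData (T p q : ℂ) (t : ℝ) : Prop where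
  hp : normSq p = 1
  h : conj T * p = T * q
  hT : 0 < T.im
  ht : 0 < t
  hpq : p ≠ q

theorem mem_disc_iff (z : ℂ) : z ∈ unitDisc ↔ normSq z ≤ 1 := by
  rw [normSq_eq_norm_sq]; simp [unitDisc, sq_le_one_iff_abs_le_one]

variable {T p q : ℂ} {t : ℝ}

theorem MobData.den_ne (H : MobData T p q t) {z : ℂ} (hz : z ∈ unitDisc) :
    T * (z - q) - I * t * (z - p) ≠ 0 := by
  intro h0
  have hid := mob_id T p q z t H.hp H.h
  rw [mem_disc_iff] at hz
  have h1 : normSq (T * (z - q) + I * t * (z - p)) = 0 := by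
    rw [h0, map_zero] at hid
    have := mul_nonneg (mul_pos (mul_pos (by norm_num : (0:ℝ) < 4) H.ht) H.hT).le (sub_nonneg.2 hz)
    linarith [normSq_nonneg (T * (z - q) + I * t * (z - p))]
  rw [normSq_eq_zero] at h1
  have hT0 : T ≠ 0 := by rintro rfl; simpa using H.hT
  have ht0 : (t:ℂ) ≠ 0 := by exact_mod_cast H.ht.ne'
  have hA : T * (z - q) = 0 := by linear_combination (h0 + h1) / 2
  have hB : (I * t) * (z - p) = 0 := by linear_combination (h1 - h0) / 2
  have hzq := sub_eq_zero.1 ((mul_eq_zero.1 hA).resolve_left hT0)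
  have hzp := sub_eq_zero.1 ((mul_eq_zero.1 hB).resolve_left (mul_ne_zero I_ne_zero ht0))
  exact H.hpq (hzp.symm.trans hzq)

theorem MobData.mapsTo (H : MobData T p q t) {z : ℂ} (hz : z ∈ unitDisc) :
    mob T p q t z ∈ unitDisc := by
  have hd := H.den_ne hz
  have hid := mob_id T p q z t H.hp H.h
  rw [mem_disc_iff] at *
  rw [mob, map_div₀, div_le_one (normSq_pos.2 hd)]
  have := mul_nonneg (mul_pos (mul_pos (by norm_num : (0:ℝ) < 4) H.ht) H.hT).le (sub_nonneg.2 hz)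
  linarith

theorem MobData.inv_den_ne (H : MobData T p q t) {w : ℂ} (hw : w ∈ unitDisc) :
    T * (1 - w) + I * t * (1 + w) ≠ 0 := by
  intro h0
  rw [mem_disc_iff] at hw
  have h1 : T * normSq (1 - w) + I * t * ((1 + w) * conj (1 - w)) = 0 := by
    rw [← mul_conj]; linear_combination conj (1 - w) * h0
  have h2 := congrArg im h1
  have h3 : T.im * normSq (1 - w) + t * (1 - normSq w) = 0 := by
    simp [normSq_apply] at h2 ⊢
    linear_combination h2
  have h4 : 0 ≤ t * (1 - normSq w) := mul_nonneg H.ht.le (sub_nonneg.2 hw)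
  have h5 : 0 ≤ T.im * normSq (1 - w) := mul_nonneg H.hT.le (normSq_nonneg _)
  have h6 : T.im * normSq (1 - w) = 0 := by linarith
  have h7 := normSq_eq_zero.1 ((mul_eq_zero.1 h6).resolve_left H.hT.ne')
  have h8 : w = 1 := (sub_eq_zero.1 h7).symm
  have ht0 : (t:ℂ) ≠ 0 := by exact_mod_cast H.ht.ne'
  subst h8
  have : I * t * (1 + 1) ≠ 0 := mul_ne_zero (mul_ne_zero I_ne_zero ht0) (by norm_num)
  apply this
  linear_combination h0

theorem MobData.inv_eq (H : MobData T p q t) {w : ℂ} (hw : w ∈ unitDisc) :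
    T * (mobInv T p q t w - q) + I * t * (mobInv T p q t w - p) =
      w * (T * (mobInv T p q t w - q) - I * t * (mobInv T p q t w - p)) := by
  have hd := H.inv_den_ne hw
  have : mobInv T p q t w * (T * (1 - w) + I * t * (1 + w)) =
    (T * q * (1 - w) + I * t * p * (1 + w)) := div_mul_cancel₀ _ hd
  linear_combination this

theorem MobData.inv_mapsTo (H : MobData T p q t) {w : ℂ} (hw : w ∈ unitDisc) :
    mobInv T p q t w ∈ unitDisc := by
  have he := H.inv_eq hw
  have hid := mob_id T p q (mobInv T p q t w) t H.hp H.h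
  rw [mem_disc_iff] at *
  by_contra! hlt
  rw [he, map_mul] at hid
  have h1 : 4 * t * T.im * (1 - normSq (mobInv T p q t w)) < 0 :=
    mul_neg_of_pos_of_neg (mul_pos (mul_pos (by norm_num : (0:ℝ) < 4) H.ht) H.hT) (by linarith)
  rw [← hid] at h1
  have := mul_nonneg (normSq_nonneg (T * (mobInv T p q t w - q) - I * t * (mobInv T p q t w - p))) (sub_nonneg.2 hw)
  linarith

theorem MobData.right_inv (H : MobData T p q t) {w : ℂ} (hw : w ∈ unitDisc) :
    mob T p q t (mobInv T p q t w) = w := by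
  have he := H.inv_eq hw
  rw [mob, div_eq_iff (H.den_ne (H.inv_mapsTo hw)), he]

theorem MobData.left_inv (H : MobData T p q t) {z : ℂ} (hz : z ∈ unitDisc) :
    mobInv T p q t (mob T p q t z) = z := by
  have hw := H.mapsTo hz
  have he : mob T p q t z * (T * (z - q) - I * t * (z - p)) = (T * (z - q) + I * t * (z - p)) :=
    div_mul_cancel₀ _ (H.den_ne hz)
  rw [mobInv, div_eq_iff (H.inv_den_ne hw)]
  linear_combination he

theorem MobData.confAut (H : MobData T p q t) : IsConfAut (mob T p q t) := by
  have hsub : Metric.ball (0:ℂ) 1 ⊆ unitDisc := Metric.ball_subset_closedBall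
  refine ⟨?_, ?_, ?_⟩
  · exact ContinuousOn.div (by fun_prop) (by fun_prop) fun z hz => H.den_ne hz
  · exact Set.InvOn.bijOn ⟨fun z hz => H.left_inv hz, fun z hz => H.right_inv hz⟩
      (fun z hz => H.mapsTo hz) (fun z hz => H.inv_mapsTo hz)
  · exact DifferentiableOn.div (by fun_prop) (by fun_prop) fun z hz => H.den_ne (hsub hz)

theorem MobData.confAut_inv (H : MobData T p q t) : IsConfAut (mobInv T p q t) := by
  have hsub : Metric.ball (0:ℂ) 1 ⊆ unitDisc := Metric.ball_subset_closedBall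
  refine ⟨?_, ?_, ?_⟩
  · exact ContinuousOn.div (by fun_prop) (by fun_prop) fun z hz => H.inv_den_ne hz
  · exact Set.InvOn.bijOn ⟨fun z hz => H.right_inv hz, fun z hz => H.left_inv hz⟩
      (fun z hz => H.inv_mapsTo hz) (fun z hz => H.mapsTo hz)
  · exact DifferentiableOn.div (by fun_prop) (by fun_prop) fun z hz => H.inv_den_ne (hsub hz)

theorem confAut_comp {f g : ℂ → ℂ} (hf : IsConfAut f) (hg : IsConfAut g) :
    IsConfAut (f ∘ g) := by
  refine ⟨hf.1.comp hg.1 hg.2.1.mapsTo, hf.2.1.comp hg.2.1, hf.2.2.comp hg.2.2 ?_⟩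
  intro z hz
  simpa using confAut_ball hg (by simpa using hz)

def ratT (u₁ u₃ r : ℂ) : ℂ := (r - u₁) / (r - u₃)

def parT (u₁ u₂ u₃ u₄ : ℂ) : ℝ := Real.sqrt (-(ratT u₁ u₃ u₂).im / (ratT u₁ u₃ u₄).im)

theorem ccw_facts {u₁ u₂ u₃ u₄ : ℂ} (h : CCW4 u₁ u₂ u₃ u₄) :
    MobData (ratT u₁ u₃ u₂) u₁ u₃ (parT u₁ u₂ u₃ u₄) ∧ (ratT u₁ u₃ u₄).im < 0 ∧ u₂ - u₃ ≠ 0 ∧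
    u₄ - u₃ ≠ 0 ∧ ratT u₁ u₃ u₄ * (parT u₁ u₂ u₃ u₄ : ℂ) ^ 2 = - ratT u₁ u₃ u₂ ∧
    ‖u₁‖ = 1 ∧ ‖u₂‖ = 1 ∧ ‖u₃‖ = 1 ∧ ‖u₄‖ = 1 := by
  obtain ⟨a, b, c, d, hab, hbc, hcd, hda, e1, e2, e3, e4⟩ := h
  have n1 : ‖u₁‖ = 1 := by rw [e1, norm_exp_ofReal_mul_I]
  have n2 : ‖u₂‖ = 1 := by rw [e2, norm_exp_ofReal_mul_I]
  have n3 : ‖u₃‖ = 1 := by rw [e3, norm_exp_ofReal_mul_I]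
  have n4 : ‖u₄‖ = 1 := by rw [e4, norm_exp_ofReal_mul_I]
  have i2 : 0 < (ratT u₁ u₃ u₂).im := by
    rw [ratT, e1, e2, e3]; exact im_T1 a b c hab hbc (by linarith)
  have i4 : (ratT u₁ u₃ u₄).im < 0 := by
    rw [ratT, e1, e4, e3]; exact im_T2 a d c (by linarith) hcd (by linarith)
  have c2 : conj (ratT u₁ u₃ u₂) * u₁ = ratT u₁ u₃ u₂ * u₃ := conj_T _ _ _ n1 n3 n2
  have c4 : conj (ratT u₁ u₃ u₄) * u₁ = ratT u₁ u₃ u₄ * u₃ := conj_T _ _ _ n1 n3 n4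
  have d2 : u₂ - u₃ ≠ 0 := by intro h0; rw [ratT, h0] at i2; simp at i2
  have d4 : u₄ - u₃ ≠ 0 := by intro h0; rw [ratT, h0] at i4; simp at i4
  have hpos : 0 < -(ratT u₁ u₃ u₂).im / (ratT u₁ u₃ u₄).im :=
    div_pos_of_neg_of_neg (by linarith) i4
  have hsq : (parT u₁ u₂ u₃ u₄) ^ 2 = -(ratT u₁ u₃ u₂).im / (ratT u₁ u₃ u₄).im :=
    Real.sq_sqrt hpos.le
  refine ⟨⟨?_, c2, i2, Real.sqrt_pos.2 hpos, ?_⟩, i4, d2, d4, ?_, n1, n2, n3, n4⟩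
  · rw [normSq_eq_norm_sq, n1]; norm_num
  · rintro rfl
    rw [ratT, div_self d2] at i2
    simp at i2
  · have hu1 : u₁ ≠ 0 := by rintro rfl; simp at n1
    have hu3 : u₃ ≠ 0 := by rintro rfl; simp at n3
    rw [← ofReal_pow, hsq]
    generalize ratT u₁ u₃ u₂ = A at *
    generalize ratT u₁ u₃ u₄ = B at *
    have hcr : conj A * B = A * conj B := by
      apply mul_right_cancel₀ (mul_ne_zero hu1 hu3)
      linear_combination B * u₃ * c2 - A * u₃ * c4
    have him := congrArg im hcr
    simp at him
    have hB := i4.ne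
    apply Complex.ext
    · simp [-ofReal_div, -ofReal_neg]
      field_simp
      linarith
    · simp [-ofReal_div, -ofReal_neg]
      field_simp

def theF (u : ℂ × ℂ × ℂ × ℂ) (z : ℂ) : ℂ :=
  mob (ratT u.1 u.2.2.1 u.2.1) u.1 u.2.2.1 (parT u.1 u.2.1 u.2.2.1 u.2.2.2) z

theorem theF_vals {u₁ u₂ u₃ u₄ : ℂ} (h : CCW4 u₁ u₂ u₃ u₄) :
    theF (u₁, u₂, u₃, u₄) u₁ = 1 ∧ theF (u₁, u₂, u₃, u₄) u₃ = -1 ∧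
    theF (u₁, u₂, u₃, u₄) u₄ = - theF (u₁, u₂, u₃, u₄) u₂ ∧
    theF (u₁, u₂, u₃, u₄) u₂ ^ 2 ≠ 1 := by
  obtain ⟨H, i4, d2, d4, hr, n1, n2, n3, n4⟩ := ccw_facts h
  have m : ∀ {x : ℂ}, ‖x‖ = 1 → x ∈ unitDisc := fun {x} hx => by simp [unitDisc, hx]
  have D1 := H.den_ne (m n1)
  have D2 := H.den_ne (m n2)
  have D3 := H.den_ne (m n3)
  have D4 := H.den_ne (m n4)
  have k2 : ratT u₁ u₃ u₂ * (u₂ - u₃) = u₂ - u₁ := div_mul_cancel₀ _ d2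
  have k4 : ratT u₁ u₃ u₄ * (u₄ - u₃) = u₄ - u₁ := div_mul_cancel₀ _ d4
  have hT0 : ratT u₁ u₃ u₂ ≠ 0 := by intro h0; have := H.hT; rw [h0] at this; simp at this
  have ht := H.ht
  have ht0 : (parT u₁ u₂ u₃ u₄ : ℂ) ≠ 0 := by exact_mod_cast ht.ne'
  have v1 : theF (u₁, u₂, u₃, u₄) u₁ = 1 := by
    simp only [theF, mob]
    rw [div_eq_one_iff_eq D1]; ring
  have v3 : theF (u₁, u₂, u₃, u₄) u₃ = -1 := by
    simp only [theF, mob]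
    rw [div_eq_iff D3]; ring
  refine ⟨v1, v3, ?_, ?_⟩
  · simp only [theF, mob]
    rw [← neg_div, div_eq_div_iff D4 D2]
    rw [← k2, ← k4]
    generalize (parT u₁ u₂ u₃ u₄ : ℂ) = t at *
    generalize ratT u₁ u₃ u₂ = A at *
    generalize ratT u₁ u₃ u₄ = B at *
    have hI := I_sq
    linear_combination (2 * A * (u₂ - u₃) * (u₄ - u₃)) * hr - 2 * A * (u₂ - u₃) * (u₄ - u₃) * t ^ 2 * B * hI
  · intro h1
    have hne := H.confAut.2.1.injOn
    have hor : theF (u₁, u₂, u₃, u₄) u₂ = 1 ∨ theF (u₁, u₂, u₃, u₄) u₂ = -1 := by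
      have hx : (theF (u₁, u₂, u₃, u₄) u₂ - 1) * (theF (u₁, u₂, u₃, u₄) u₂ + 1) = 0 := by linear_combination h1
      exact (mul_eq_zero.1 hx).imp sub_eq_zero.1 eq_neg_of_add_eq_zero_left
    rcases hor with h2 | h2
    · have : u₂ = u₁ := hne (m n2) (m n1) (h2.trans v1.symm)
      apply hT0
      simp [ratT, this]
    · have : u₂ = u₃ := hne (m n2) (m n3) (h2.trans v3.symm)
      exact d2 (sub_eq_zero.2 this)

theorem theF_cont {u : ℂ × ℂ × ℂ × ℂ} (h : CCW4 u.1 u.2.1 u.2.2.1 u.2.2.2) {z : ℂ}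
    (hz : z ∈ unitDisc) : ContinuousAt (fun x : (ℂ × ℂ × ℂ × ℂ) × ℂ => theF x.1 x.2) (u, z) := by
  obtain ⟨H, i4, d2, d4, hr, n1, n2, n3, n4⟩ := ccw_facts h
  have cT : ContinuousAt (fun x : (ℂ × ℂ × ℂ × ℂ) × ℂ => ratT x.1.1 x.1.2.2.1 x.1.2.1) (u, z) :=
    ContinuousAt.div (by fun_prop) (by fun_prop) d2
  have cT4 : ContinuousAt (fun x : (ℂ × ℂ × ℂ × ℂ) × ℂ => ratT x.1.1 x.1.2.2.1 x.1.2.2.2) (u, z) :=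
    ContinuousAt.div (by fun_prop) (by fun_prop) d4
  have ct : ContinuousAt (fun x : (ℂ × ℂ × ℂ × ℂ) × ℂ =>
      parT x.1.1 x.1.2.1 x.1.2.2.1 x.1.2.2.2) (u, z) := by
    refine Real.continuous_sqrt.continuousAt.comp (ContinuousAt.div ?_ ?_ i4.ne)
    · exact (continuous_im.continuousAt.comp cT).neg
    · exact continuous_im.continuousAt.comp cT4
  have ct' : ContinuousAt (fun x : (ℂ × ℂ × ℂ × ℂ) × ℂ =>
      (parT x.1.1 x.1.2.1 x.1.2.2.1 x.1.2.2.2 : ℂ)) (u, z) :=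
    continuous_ofReal.continuousAt.comp ct
  exact ContinuousAt.div (by fun_prop) (by fun_prop) (H.den_ne hz)

/-- For any four distinct points `u₁, u₂, u₋₁, u₋₂` of the unit circle in counterclockwise
order, there is a unique conformal automorphism `f` of the closed unit disc with `f u₁ = 1`,
`f u₋₁ = -1`, and `f u₋₂ = - f u₂`; moreover it depends continuously on the four points in the
sup metric on maps of the closed disc. -/
theorem fourPointAut_exists_unique_continuous :
    ∃ F : ℂ × ℂ × ℂ × ℂ → ℂ → ℂ,
      (∀ u : ℂ × ℂ × ℂ × ℂ, CCW4 u.1 u.2.1 u.2.2.1 u.2.2.2 →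
        (IsConfAut (F u) ∧ F u u.1 = 1 ∧ F u u.2.2.1 = -1 ∧
          F u u.2.2.2 = - F u u.2.1) ∧
        (∀ g : ℂ → ℂ, IsConfAut g → g u.1 = 1 → g u.2.2.1 = -1 → g u.2.2.2 = - g u.2.1 →
          Set.EqOn g (F u) unitDisc)) ∧
      (∀ u : ℂ × ℂ × ℂ × ℂ, CCW4 u.1 u.2.1 u.2.2.1 u.2.2.2 → ∀ ε > (0 : ℝ), ∃ δ > (0 : ℝ),
        ∀ v : ℂ × ℂ × ℂ × ℂ, CCW4 v.1 v.2.1 v.2.2.1 v.2.2.2 → dist u v < δ →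
          ∀ z ∈ unitDisc, dist (F u z) (F v z) < ε) := by
  refine ⟨theF, ?_, ?_⟩
  · rintro ⟨u₁, u₂, u₃, u₄⟩ h
    simp only at h ⊢
    obtain ⟨H, i4, d2, d4, hr, n1, n2, n3, n4⟩ := ccw_facts h
    obtain ⟨v1, v3, v4, v2⟩ := theF_vals h
    have m : ∀ {x : ℂ}, ‖x‖ = 1 → x ∈ unitDisc := fun {x} hx => by simp [unitDisc, hx]
    refine ⟨⟨H.confAut, v1, v3, v4⟩, ?_⟩
    intro g hg g1 g3 g4 z hz
    have hk := confAut_comp hg H.confAut_inv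
    have L : ∀ x ∈ unitDisc, mobInv (ratT u₁ u₃ u₂) u₁ u₃ (parT u₁ u₂ u₃ u₄)
        (theF (u₁, u₂, u₃, u₄) x) = x := fun x hx => H.left_inv hx
    have key := confAut_eq_id hk
      (by rw [← v1, Function.comp_apply, L _ (m n1), g1, v1])
      (by rw [← v3, Function.comp_apply, L _ (m n3), g3, v3])
      (theF (u₁, u₂, u₃, u₄) u₂) (H.mapsTo (m n2)) v2
      (by rw [← v4, Function.comp_apply, Function.comp_apply, L _ (m n4), L _ (m n2), g4])
      (theF (u₁, u₂, u₃, u₄) z) (H.mapsTo hz)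
    rwa [Function.comp_apply, L z hz] at key
  · intro u h ε hε
    have hK : IsCompact unitDisc := isCompact_closedBall 0 1
    have := hK.eventually_forall_of_forall_eventually (x₀ := u)
      (P := fun v z => dist (theF u z) (theF v z) < ε) (fun z hz => by
        have h1 := theF_cont h hz
        have h2 : ContinuousAt (fun x : (ℂ × ℂ × ℂ × ℂ) × ℂ => theF u x.2) (u, z) :=
          ContinuousAt.comp (f := fun x : (ℂ × ℂ × ℂ × ℂ) × ℂ => (u, x.2))
            (g := fun x : (ℂ × ℂ × ℂ × ℂ) × ℂ => theF x.1 x.2) h1 (by fun_prop)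
        have h3 := h2.dist h1
        exact h3.eventually_lt continuousAt_const (by simpa using hε))
    obtain ⟨δ, hδ, hB⟩ := Metric.eventually_nhds_iff.1 this
    exact ⟨δ, hδ, fun v _ hv z hz => hB (by rwa [dist_comm]) z hz⟩
end
end

section
/- For k ∈ ℕ ∪ {∞}, let C_k ⊆ S² be a closed region bounded by a simple closed curve: there are continuous injective maps φ_k : S¹ → S² such that the topological frontier of C_k in S² equals the image of φ_k, the complement S² \ image(φ_k) has exactly two connected components, and C_k is the closure of one of them. Suppose φ_k → φ_∞ uniformly, C_k → C_∞ in Hausdorff distance, and the curve image(φ_∞) has surface measure zero. Then the surface measure of C_k converges to the surface measure of C_∞. -/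
open Metric Filter MeasureTheory

noncomputable section

/-- The Euclidean 3-space. -/
abbrev E3 : Type := EuclideanSpace ℝ (Fin 3)

/-- The unit 2-sphere in `ℝ³`. -/
abbrev Sph : Type := Metric.sphere (0 : E3) 1

/-- The unit circle in `ℂ`. -/
abbrev Circ : Type := Metric.sphere (0 : ℂ) 1

/-- The surface measure on the sphere: the 2-dimensional Hausdorff measure. -/
def μSph : Measure Sph := Measure.hausdorffMeasure 2

/-- `C` is a closed region bounded by the simple closed curve `φ`: the frontier of `C` is the
image of `φ`, the complement of the curve has exactly two connected components, and `C` is the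
closure of one of them. -/
def BoundedRegion (C : Set Sph) (φ : Circ → Sph) : Prop :=
  frontier C = Set.range φ ∧
  (∃ a b : Sph, a ∈ (Set.range φ)ᶜ ∧ b ∈ (Set.range φ)ᶜ ∧
    connectedComponentIn (Set.range φ)ᶜ a ≠ connectedComponentIn (Set.range φ)ᶜ b ∧
    ∀ z ∈ (Set.range φ)ᶜ,
      connectedComponentIn (Set.range φ)ᶜ z = connectedComponentIn (Set.range φ)ᶜ a ∨
      connectedComponentIn (Set.range φ)ᶜ z = connectedComponentIn (Set.range φ)ᶜ b) ∧
  (∃ z ∈ (Set.range φ)ᶜ, C = closure (connectedComponentIn (Set.range φ)ᶜ z))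

lemma sph_finite : μSph Set.univ < ⊤ := by
  let f : (Fin 2 → ℝ) → E3 := fun p =>
    !₂[Real.sin (p 0) * Real.cos (p 1), Real.sin (p 0) * Real.sin (p 1), Real.cos (p 0)]
  have hf : ContDiff ℝ 1 f := by
    rw [contDiff_euclidean]
    intro i
    fin_cases i <;> simp [f] <;> fun_prop
  let K : Set (Fin 2 → ℝ) := Metric.closedBall 0 Real.pi
  have hK : IsCompact K := isCompact_closedBall _ _
  obtain ⟨L, hL⟩ := (hf.locallyLipschitz.locallyLipschitzOn (s := K)).exists_lipschitzOnWith_of_compact hK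
  have h1 := hL.hausdorffMeasure_image_le (d := 2) (by norm_num)
  have h2 : Measure.hausdorffMeasure 2 K < ⊤ := by
    have : (Measure.hausdorffMeasure 2 : Measure (Fin 2 → ℝ)) = volume := by
      have := hausdorffMeasure_pi_real (ι := Fin 2)
      simpa using this
    rw [this]
    exact hK.measure_lt_top
  have h3 : Subtype.val '' (Set.univ : Set Sph) ⊆ f '' K := by
    rintro _ ⟨⟨x, hx⟩, -, rfl⟩
    have hx' : x 0 ^ 2 + x 1 ^ 2 + x 2 ^ 2 = 1 := by
      have : ‖x‖ = 1 := by simpa using hx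
      have h := EuclideanSpace.real_norm_sq_eq x
      rw [this, Fin.sum_univ_three] at h
      linarith
    let z : ℂ := ⟨x 0, x 1⟩
    have hz : ‖z‖ = √(1 - x 2 ^ 2) := by
      rw [Complex.norm_def, Complex.normSq_apply]
      congr 1
      simp only [z]
      linarith
    refine ⟨![Real.arccos (x 2), Complex.arg z], ?_, ?_⟩
    · simp only [K, mem_closedBall, dist_zero_right]
      rw [pi_norm_le_iff_of_nonneg Real.pi_pos.le]
      intro i
      fin_cases i
      · simpa [abs_of_nonneg (Real.arccos_nonneg _)] using Real.arccos_le_pi _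
      · simpa using Complex.abs_arg_le_pi z
    · ext i
      fin_cases i
      · simp only [f]
        simp [Real.sin_arccos, ← hz, Complex.norm_mul_cos_arg, z]
      · simp only [f]
        simp [Real.sin_arccos, ← hz, Complex.norm_mul_sin_arg, z]
      · simp only [f]
        simp
        exact Real.cos_arccos (by nlinarith [sq_nonneg (x 0), sq_nonneg (x 1)]) (by nlinarith [sq_nonneg (x 0), sq_nonneg (x 1)])
  have h4 : μSph Set.univ = Measure.hausdorffMeasure 2 (Subtype.val '' (Set.univ : Set Sph)) :=
    (isometry_subtype_coe.hausdorffMeasure_image (Or.inl (by norm_num)) _).symm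
  rw [h4]
  refine (measure_mono h3).trans_lt (h1.trans_lt ?_)
  refine ENNReal.mul_lt_top ?_ h2
  exact ENNReal.rpow_lt_top_of_nonneg (by norm_num) ENNReal.coe_ne_top

lemma sph_locconn : LocallyConnectedSpace Sph := by
  have : Fact (Module.finrank ℝ E3 = 2 + 1) := ⟨by simp⟩
  exact ChartedSpace.locallyConnectedSpace (EuclideanSpace ℝ (Fin 2)) Sph

/-- If closed regions `C k` bounded by simple closed curves `φ k` converge in Hausdorff
distance to a region `Clim` bounded by `φlim`, the curves converge uniformly, and the limiting
curve has surface measure zero, then the surface measure of `C k` converges to that of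
`Clim`. -/
theorem area_convergence
    (C : ℕ → Set Sph) (Clim : Set Sph) (φ : ℕ → Circ → Sph) (φlim : Circ → Sph)
    (hφc : ∀ k, Continuous (φ k)) (hφi : ∀ k, Function.Injective (φ k))
    (hlimc : Continuous φlim) (hlimi : Function.Injective φlim)
    (hreg : ∀ k, BoundedRegion (C k) (φ k)) (hreglim : BoundedRegion Clim φlim)
    (hunif : TendstoUniformly φ φlim atTop)
    (hH : Tendsto (fun k => Metric.hausdorffDist (C k) Clim) atTop (nhds 0))
    (hnull : μSph (Set.range φlim) = 0) :
    Tendsto (fun k => μSph (C k)) atTop (nhds (μSph Clim)) := by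
  have := sph_locconn
  have : IsFiniteMeasure μSph := ⟨sph_finite⟩
  have hcl : ∀ (D : Set Sph) (ψ : Circ → Sph), BoundedRegion D ψ → IsClosed D ∧ D.Nonempty := by
    rintro D ψ ⟨-, -, z, hz, rfl⟩
    exact ⟨isClosed_closure, z, subset_closure (mem_connectedComponentIn hz)⟩
  have hfin : ∀ k, hausdorffEDist (C k) Clim ≠ ⊤ := fun k =>
    hausdorffEDist_ne_top_of_nonempty_of_bounded (hcl _ _ (hreg k)).2 (hcl _ _ hreglim).2
      (hcl _ _ (hreg k)).1.isCompact.isBounded (hcl _ _ hreglim).1.isCompact.isBounded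
  have hlt : ∀ ε > 0, ∀ᶠ k in atTop, hausdorffDist (C k) Clim < ε := fun ε hε =>
    hH.eventually (gt_mem_nhds hε)
  refine tendsto_measure_of_ae_tendsto_indicator_of_isFiniteMeasure atTop
    (hcl _ _ hreglim).1.measurableSet (fun k => (hcl _ _ (hreg k)).1.measurableSet) ?_
  have hae : ∀ᵐ x ∂μSph, x ∉ Set.range φlim := measure_eq_zero_iff_ae_notMem.1 hnull
  filter_upwards [hae] with x hx
  have hΓ : IsOpen (Set.range φlim)ᶜ := (isCompact_range hlimc).isClosed.isOpen_compl
  by_cases hxC : x ∈ Clim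
  · obtain ⟨r, hr, hball⟩ := Metric.isOpen_iff.1 hΓ x hx
    obtain ⟨U, ⟨hUo, hxU, hUc⟩, hUb⟩ :=
      (LocallyConnectedSpace.open_connected_basis x).mem_iff.1 (ball_mem_nhds x (half_pos hr))
    obtain ⟨ε, hε, hεU⟩ := Metric.isOpen_iff.1 hUo x hxU
    filter_upwards [hlt ε hε, Metric.tendstoUniformly_iff.1 hunif (r/2) (half_pos hr)] with k hk1 hk2
    refine iff_of_true ?_ hxC
    by_contra hxk
    obtain ⟨y, hy, hyx⟩ := exists_dist_lt_of_hausdorffDist_lt' hxC hk1 (hfin k)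
    have hfr : ∃ w ∈ U, w ∈ frontier (C k) := by
      by_contra hno
      push Not at hno
      have hcov : ∀ w ∈ U, w ∈ C k → w ∈ interior (C k) := fun w hw hwC => by
        by_contra hi
        exact hno w hw ⟨subset_closure hwC, hi⟩
      obtain ⟨w, -, hw1, hw2⟩ := hUc.isPreconnected (interior (C k)) (C k)ᶜ isOpen_interior
        (hcl _ _ (hreg k)).1.isOpen_compl
        (fun w hw => (em (w ∈ C k)).imp (hcov w hw) id)
        ⟨y, hεU hyx, hcov y (hεU hyx) hy⟩ ⟨x, hxU, hxk⟩
      exact hw2 (interior_subset hw1)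
    obtain ⟨w, hwU, hw⟩ := hfr
    rw [(hreg k).1] at hw
    obtain ⟨t, rfl⟩ := hw
    have h1 : dist (φ k t) x < r / 2 := hUb hwU
    have h2 := hk2 t
    have h3 := dist_triangle (φlim t) (φ k t) x
    exact hball (show dist (φlim t) x < r by linarith) ⟨t, rfl⟩
  · obtain ⟨ε, hε, hεU⟩ := Metric.isOpen_iff.1 (hcl _ _ hreglim).1.isOpen_compl x hxC
    filter_upwards [hlt ε hε] with k hk
    refine iff_of_false (fun hxk => ?_) hxC
    obtain ⟨y, hy, hyx⟩ := exists_dist_lt_of_hausdorffDist_lt hxk hk (hfin k)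
    exact hεU (show dist y x < ε by rwa [dist_comm]) hy
end
end

section
/- Let f, g : 𝔻 → ℂ be continuous injective maps from the closed unit disc that are holomorphic on the open unit disc, with f(𝔻) = g(𝔻), f(1) = g(1), and f(-1) = g(-1). Suppose there exist points w_f, w_g ∈ S¹ \ {1, -1} such that f(w_f) = g(w_g) and f(-w_f) = g(-w_g). Then f = g. -/
open Metric

noncomputable section

/-- The unit circle in `ℂ`. -/
def unitCircle : Set ℂ := Metric.sphere 0 1

open Set Filter Topology

namespace FourPt

lemma no_log (L : ℝ → ℂ) (hL : Continuous L)
    (h : ∀ t : ℝ, Complex.exp (L t) = Complex.exp (t * Complex.I))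
    (hp : L 0 = L (2 * Real.pi)) : False := by
  have h0 := h 0
  have hc : Continuous fun t : ℝ => (t : ℂ) * Complex.I + (L 0) := by fun_prop
  have h0' : Complex.exp (L 0) = 1 := by simpa using h0
  have := Complex.isCoveringMap_exp.eq_of_comp_eq hL hc (by
    funext t
    apply Subtype.ext
    simp only [Function.comp]
    rw [Complex.exp_add, h t, h0', mul_one]) 0 (by simp)
  have h2 := congrFun this (2 * Real.pi)
  rw [← hp] at h2
  simp at h2

lemma invFunOn_cont (g : ℂ → ℂ) (K : Set ℂ) (hK : IsCompact K) (hgc : ContinuousOn g K)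
    (hgi : InjOn g K) : ContinuousOn (Function.invFunOn g K) (g '' K) := by
  rw [continuousOn_iff_isClosed]
  intro t ht
  refine ⟨g '' (t ∩ K), ?_, ?_⟩
  · have : IsCompact (t ∩ K) := hK.inter_left ht
    exact (this.image_of_continuousOn (hgc.mono inter_subset_right)).isClosed
  · ext y
    constructor
    · rintro ⟨hy, x, hx, rfl⟩
      have := hgi.leftInvOn_invFunOn hx
      simp only [mem_preimage, this] at hy
      exact ⟨⟨x, ⟨hy, hx⟩, rfl⟩, ⟨x, hx, rfl⟩⟩
    · rintro ⟨⟨x, ⟨hxt, hx⟩, rfl⟩, h⟩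
      refine ⟨?_, h⟩
      have := hgi.leftInvOn_invFunOn hx
      simpa only [mem_preimage, this] using hxt

lemma bdry (g : ℂ → ℂ) (hgc : ContinuousOn g (closedBall 0 1)) (hgi : InjOn g (closedBall 0 1))
    (ζ : ℂ) (hζ : ‖ζ‖ = 1) : g '' closedBall 0 1 ∉ 𝓝 (g ζ) := by
  intro hn
  set p := g ζ with hpdef
  have hK : IsCompact (closedBall (0 : ℂ) 1) := isCompact_closedBall 0 1
  obtain ⟨r, hr, hrs⟩ := nhds_basis_closedBall.mem_iff.1 hn
  have hsc : IsSimplyConnected (ball (0 : ℂ) 1) := by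
    have : ContractibleSpace (ball (0 : ℂ) 1) :=
      (convex_ball (0 : ℂ) 1).contractibleSpace ⟨0, by simp⟩
    change SimplyConnectedSpace _
    infer_instance
  have hgb : ContinuousOn g (ball 0 1) := hgc.mono ball_subset_closedBall
  obtain ⟨L, hLc, hLe⟩ := Complex.exists_continuousOn_eqOn_exp_comp hsc isOpen_ball
    (g := fun z => g z - p) (hgb.sub continuousOn_const) (by
      rintro ⟨z, hz, hz0⟩
      have := hgi (ball_subset_closedBall hz) (by simp [hζ]) (sub_eq_zero.1 hz0)
      rw [this] at hz
      simp [hζ] at hz)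
  let γ : ℝ → ℂ := fun t => p + r * Complex.exp (t * Complex.I)
  have hγc : Continuous γ := by fun_prop
  have hγm : ∀ t, γ t ∈ g '' closedBall 0 1 := fun t => hrs (by
    simp [γ, dist_eq_norm, abs_of_pos hr, Complex.norm_exp_ofReal_mul_I])
  let η : ℝ → ℂ := fun t => Function.invFunOn g (closedBall 0 1) (γ t)
  have hηc : Continuous η :=
    (invFunOn_cont g _ hK hgc hgi).comp_continuous hγc hγm
  have hηm : ∀ t, η t ∈ closedBall (0 : ℂ) 1 := fun t => Function.invFunOn_mem (hγm t)
  have hηe : ∀ t, g (η t) = γ t := fun t => Function.invFunOn_eq (hγm t)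
  obtain ⟨δ, hδ, hu⟩ := Metric.uniformContinuousOn_iff.1
    (hK.uniformContinuousOn_of_continuous hgc) r hr
  set ε := min 1 δ / 2 with hε
  have hm0 : 0 < min 1 δ := lt_min one_pos hδ
  have hm1 := min_le_left 1 δ
  have hm2 := min_le_right 1 δ
  have hε0 : 0 < ε := by positivity
  have hε1 : ε < 1 := by linarith
  have hεδ : ε < δ := by linarith
  let σ : ℝ → ℂ := fun t => ((1 - ε : ℝ) : ℂ) * η t
  have hσc : Continuous σ := by fun_prop
  have hηn : ∀ t, ‖η t‖ ≤ 1 := fun t => by simpa using hηm t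
  have hσm : ∀ t, σ t ∈ ball (0 : ℂ) 1 := fun t => by
    have h1 : ‖σ t‖ = (1 - ε) * ‖η t‖ := by
      simp only [σ]
      rw [norm_mul, Complex.norm_real, Real.norm_of_nonneg (by linarith)]
    rw [mem_ball_zero_iff, h1]
    nlinarith [hηn t, norm_nonneg (η t)]
  have hσd : ∀ t, dist (g (σ t)) (g (η t)) < r := fun t => by
    apply hu _ (ball_subset_closedBall (hσm t)) _ (hηm t)
    have : σ t - η t = -((ε : ℂ) * η t) := by simp only [σ]; push_cast; ring
    rw [dist_eq_norm, this, norm_neg, norm_mul, Complex.norm_real, Real.norm_of_nonneg hε0.le]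
    nlinarith [hηn t]
  let c : ℝ → ℂ := fun t => r * Complex.exp (t * Complex.I)
  have hr0 : (r : ℂ) ≠ 0 := by exact_mod_cast hr.ne'
  have hc0 : ∀ t, c t ≠ 0 := fun t => mul_ne_zero hr0 (Complex.exp_ne_zero _)
  have hcn : ∀ t, ‖c t‖ = r := fun t => by
    simp [c, abs_of_pos hr, Complex.norm_exp_ofReal_mul_I]
  let u : ℝ → ℂ := fun t => (g (σ t) - p) / c t
  have hu1 : ∀ t, ‖u t - 1‖ < 1 := fun t => by
    have : u t - 1 = (g (σ t) - g (η t)) / c t := by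
      simp only [u]
      rw [hηe]
      field_simp [hc0 t]
      simp only [γ, c]; ring
    rw [this, norm_div, hcn, div_lt_one hr, ← dist_eq_norm]
    exact hσd t
  have hus : ∀ t, u t ∈ Complex.slitPlane := fun t => by
    left
    have := (abs_lt.1 ((Complex.abs_re_le_norm _).trans_lt (hu1 t))).1
    simp at this
    linarith
  have hgσ : Continuous fun t => g (σ t) := hgb.comp_continuous hσc hσm
  have hcc : Continuous c := by fun_prop
  have huc : Continuous u := (hgσ.sub continuous_const).div hcc hc0
  have hlu : Continuous fun t => Complex.log (u t) := huc.clog hus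
  refine no_log (fun t => L (σ t) - Complex.log (u t) - Complex.log r) ?_ ?_ ?_
  · exact ((hLc.comp_continuous hσc hσm).sub hlu).sub continuous_const
  · intro t
    have h1 : Complex.exp (L (σ t)) = g (σ t) - p := hLe (hσm t)
    have hu0 := Complex.slitPlane_ne_zero (hus t)
    rw [Complex.exp_sub, Complex.exp_sub, h1, Complex.exp_log hu0, Complex.exp_log hr0]
    have h2 : g (σ t) - p = u t * c t := by
      simp only [u]; rw [div_mul_cancel₀ _ (hc0 t)]
    rw [h2]
    simp only [c]
    field_simp
  · have hγp : γ (2 * Real.pi) = γ 0 := by simp [γ]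
    have hηp : η (2 * Real.pi) = η 0 := by simp only [η, hγp]
    have hσp : σ (2 * Real.pi) = σ 0 := by simp only [σ, hηp]
    have hcp : c (2 * Real.pi) = c 0 := by simp [c]
    have hup : u (2 * Real.pi) = u 0 := by simp only [u, hσp, hcp]
    simp only [hσp, hup]

lemma anal (g : ℂ → ℂ) (hgd : DifferentiableOn ℂ g (ball 0 1)) :
    AnalyticOnNhd ℂ g (ball 0 1) := hgd.analyticOnNhd isOpen_ball

lemma maps (f g : ℂ → ℂ)
    (hfi : InjOn f (closedBall 0 1)) (hfd : DifferentiableOn ℂ f (ball 0 1))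
    (hgc : ContinuousOn g (closedBall 0 1)) (hgi : InjOn g (closedBall 0 1))
    (him : f '' closedBall 0 1 = g '' closedBall 0 1) (z w : ℂ) (hz : z ∈ ball (0 : ℂ) 1)
    (hw : w ∈ closedBall (0 : ℂ) 1) (h : g w = f z) : w ∈ ball (0 : ℂ) 1 := by
  by_contra hwb
  have hw1 : ‖w‖ = 1 := le_antisymm (by simpa using hw) (by simpa using hwb)
  apply bdry g hgc hgi w hw1
  rw [h, ← him]
  rcases (anal f hfd).is_constant_or_isOpen (convex_ball 0 1).isPreconnected with ⟨c, hc⟩ | ho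
  · have h0 : (0 : ℂ) ∈ ball (0 : ℂ) 1 := by simp
    have h2 : (1 / 2 : ℂ) ∈ ball (0 : ℂ) 1 := by simp; norm_num
    have := hfi (ball_subset_closedBall h0) (ball_subset_closedBall h2)
      ((hc _ h0).trans (hc _ h2).symm)
    norm_num at this
  · exact mem_of_superset ((ho _ subset_rfl isOpen_ball).mem_nhds ⟨z, hz, rfl⟩)
      (image_mono ball_subset_closedBall)

lemma transition (f g : ℂ → ℂ)
    (hfc : ContinuousOn f (closedBall 0 1)) (hfi : InjOn f (closedBall 0 1))
    (hfd : DifferentiableOn ℂ f (ball 0 1))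
    (hgc : ContinuousOn g (closedBall 0 1)) (hgi : InjOn g (closedBall 0 1))
    (hgd : DifferentiableOn ℂ g (ball 0 1))
    (him : f '' closedBall 0 1 = g '' closedBall 0 1) :
    ∃ φ : ℂ → ℂ, ContinuousOn φ (closedBall 0 1) ∧ MapsTo φ (closedBall 0 1) (closedBall 0 1) ∧
      MapsTo φ (ball 0 1) (ball 0 1) ∧ DifferentiableOn ℂ φ (ball 0 1) ∧
      ∀ z ∈ closedBall (0 : ℂ) 1, g (φ z) = f z := by
  let φ : ℂ → ℂ := fun z => Function.invFunOn g (closedBall 0 1) (f z)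
  have him' : ∀ z ∈ closedBall (0 : ℂ) 1, f z ∈ g '' closedBall 0 1 := fun z hz => by
    rw [← him]; exact ⟨z, hz, rfl⟩
  have hφm : MapsTo φ (closedBall 0 1) (closedBall 0 1) := fun z hz =>
    Function.invFunOn_mem (him' z hz)
  have hφe : ∀ z ∈ closedBall (0 : ℂ) 1, g (φ z) = f z := fun z hz =>
    Function.invFunOn_eq (him' z hz)
  have hφc : ContinuousOn φ (closedBall 0 1) :=
    (invFunOn_cont g _ (isCompact_closedBall 0 1) hgc hgi).comp hfc him'
  have hφb : MapsTo φ (ball 0 1) (ball 0 1) := fun z hz =>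
    maps f g hfi hfd hgc hgi him z (φ z) hz (hφm (ball_subset_closedBall hz))
      (hφe z (ball_subset_closedBall hz))
  have hφi : InjOn φ (closedBall 0 1) := fun x hx y hy h => hfi hx hy (by
    rw [← hφe x hx, ← hφe y hy, h])
  refine ⟨φ, hφc, hφm, hφb, ?_, hφe⟩
  have hca : ∀ z ∈ ball (0 : ℂ) 1, ContinuousAt φ z := fun z hz =>
    (hφc.mono ball_subset_closedBall).continuousAt (isOpen_ball.mem_nhds hz)
  have hgood : ∀ z ∈ ball (0 : ℂ) 1, deriv g (φ z) ≠ 0 → DifferentiableAt ℂ φ z := by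
    intro z hz hd
    have hg1 := (hgd.differentiableAt (isOpen_ball.mem_nhds (hφb hz))).hasDerivAt
    have hf1 := (hfd.differentiableAt (isOpen_ball.mem_nhds hz)).hasDerivAt
    refine (HasDerivAt.of_comp_left (hca z hz) hg1 hf1 hd ?_).differentiableAt
    filter_upwards [isOpen_ball.mem_nhds hz] with y hy
    exact hφe y (ball_subset_closedBall hy)
  intro z hz
  apply DifferentiableAt.differentiableWithinAt
  apply AnalyticAt.differentiableAt
  apply Complex.analyticAt_of_differentiable_on_punctured_nhds_of_continuousAt _ (hca z hz)
  have hga := anal g hgd (φ z) (hφb hz)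
  rcases hga.deriv.eventually_eq_zero_or_eventually_ne_zero with h0 | h0
  · exfalso
    obtain ⟨ε, hε, hb⟩ := Metric.mem_nhds_iff.1 (inter_mem h0 (isOpen_ball.mem_nhds (hφb hz)))
    have hcst : g (φ z) = g (φ z + (ε / 2 : ℝ)) := by
      apply (convex_ball (φ z) ε).is_const_of_fderivWithin_eq_zero (𝕜 := ℂ) (f := g)
        (hgd.mono fun y hy => (hb hy).2)
      · intro y hy
        rw [fderivWithin_of_isOpen isOpen_ball hy]
        ext
        simpa using (hb hy).1
      · simpa using hε
      · simp [abs_of_pos hε, hε]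
    have hm : φ z + (ε / 2 : ℝ) ∈ ball (0 : ℂ) 1 := (hb (by simp [abs_of_pos hε, hε])).2
    have := hgi (ball_subset_closedBall (hφb hz)) (ball_subset_closedBall hm) hcst
    simp [hε.ne'] at this
  · have ht : Tendsto φ (𝓝[≠] z) (𝓝[≠] (φ z)) := by
      apply tendsto_nhdsWithin_of_tendsto_nhds_of_eventually_within
      · exact (hca z hz).tendsto.mono_left nhdsWithin_le_nhds
      · filter_upwards [self_mem_nhdsWithin,
          mem_nhdsWithin_of_mem_nhds (isOpen_ball.mem_nhds hz)] with y hy hyb h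
        exact hy (hφi (ball_subset_closedBall hyb) (ball_subset_closedBall hz) h)
    filter_upwards [ht.eventually h0,
      mem_nhdsWithin_of_mem_nhds (isOpen_ball.mem_nhds hz)] with y hy hyb
    exact hgood y hyb hy

open ComplexConjugate in
def mob (b z : ℂ) : ℂ := (z - b) / (1 - conj b * z)

open ComplexConjugate in
lemma mob_den (b z : ℂ) (hb : ‖b‖ < 1) (hz : ‖z‖ ≤ 1) : 1 - conj b * z ≠ 0 := by
  intro h
  have h1 : conj b * z = 1 := (sub_eq_zero.1 h).symm
  have h2 : ‖b‖ * ‖z‖ = 1 := by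
    have := congrArg norm h1
    simpa using this
  nlinarith [norm_nonneg b, norm_nonneg z]

open ComplexConjugate in
lemma mob_ball (b z : ℂ) (hb : ‖b‖ < 1) (hz : ‖z‖ < 1) : ‖mob b z‖ < 1 := by
  have hd := mob_den b z hb hz.le
  rw [mob, norm_div, div_lt_one (norm_pos_iff.2 hd)]
  apply lt_of_pow_lt_pow_left₀ 2 (norm_nonneg _)
  have hb2 : ‖b‖ ^ 2 < 1 := by nlinarith [norm_nonneg b]
  have hz2 : ‖z‖ ^ 2 < 1 := by nlinarith [norm_nonneg z]
  rw [← Complex.normSq_eq_norm_sq, Complex.normSq_apply] at *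
  rw [← Complex.normSq_eq_norm_sq, Complex.normSq_apply] at *
  simp at *
  nlinarith [mul_pos (sub_pos.2 hb2) (sub_pos.2 hz2)]

open ComplexConjugate in
lemma mob_inv (b z : ℂ) (hb : ‖b‖ < 1) (hz : ‖z‖ < 1) : mob (-b) (mob b z) = z := by
  have hd := mob_den b z hb hz.le
  have hd2 := mob_den (-b) (mob b z) (by simpa using hb) (mob_ball b z hb hz).le
  have hm : mob b z * (1 - conj b * z) = z - b := div_mul_cancel₀ _ hd
  generalize mob b z = m at *
  rw [mob, div_eq_iff hd2]
  simp only [map_neg]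
  linear_combination hm

lemma mob_diff (b : ℂ) (hb : ‖b‖ < 1) : DifferentiableOn ℂ (mob b) (ball 0 1) := by
  intro z hz
  have hd := mob_den b z hb (by simpa using (ball_subset_closedBall hz))
  apply DifferentiableAt.differentiableWithinAt
  unfold mob
  fun_prop (disch := exact hd)

open ComplexConjugate in
lemma auto (φ ψ : ℂ → ℂ) (hφ : MapsTo φ (ball 0 1) (ball 0 1))
    (hφd : DifferentiableOn ℂ φ (ball 0 1)) (hψ : MapsTo ψ (ball 0 1) (ball 0 1))
    (hψd : DifferentiableOn ℂ ψ (ball 0 1)) (hi : ∀ z ∈ ball (0 : ℂ) 1, ψ (φ z) = z) :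
    ∃ b c : ℂ, ∀ z ∈ ball (0 : ℂ) 1, φ z - b = c * z * (1 - conj b * φ z) := by
  have h0 : (0 : ℂ) ∈ ball (0 : ℂ) 1 := by simp
  set b := φ 0 with hbd
  have hb : ‖b‖ < 1 := by simpa using hφ h0
  have hb' : ‖-b‖ < 1 := by simpa using hb
  have hM : ∀ b : ℂ, ‖b‖ < 1 → MapsTo (mob b) (ball 0 1) (ball 0 1) := fun b hb z hz => by
    simpa using mob_ball b z hb (by simpa using hz)
  let Ψ : ℂ → ℂ := mob b ∘ φ
  let Θ : ℂ → ℂ := ψ ∘ mob (-b)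
  have hΨm : MapsTo Ψ (ball 0 1) (ball 0 1) := (hM b hb).comp hφ
  have hΘm : MapsTo Θ (ball 0 1) (ball 0 1) := hψ.comp (hM _ hb')
  have hΨd : DifferentiableOn ℂ Ψ (ball 0 1) := (mob_diff b hb).comp hφd hφ
  have hΘd : DifferentiableOn ℂ Θ (ball 0 1) := hψd.comp (mob_diff _ hb') (hM _ hb')
  have hΨ0 : Ψ 0 = 0 := by simp [Ψ, mob, ← hbd]
  have hΘ0 : Θ 0 = 0 := by
    have : Θ 0 = ψ (φ 0) := by simp [Θ, mob, ← hbd]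
    rw [this, hi 0 h0]
  have hΘΨ : ∀ z ∈ ball (0 : ℂ) 1, Θ (Ψ z) = z := fun z hz => by
    simp only [Θ, Ψ, Function.comp]
    rw [mob_inv b _ hb (by simpa using hφ hz), hi z hz]
  have h2 : (1 / 2 : ℂ) ∈ ball (0 : ℂ) 1 := by simp; norm_num
  have hle : ‖Ψ (1 / 2)‖ ≤ ‖(1 / 2 : ℂ)‖ := Complex.norm_le_norm_of_mapsTo_ball hΨd
    (hΨm.mono_right ball_subset_closedBall) hΨ0 (by simpa using h2)
  have hge : ‖Θ (Ψ (1 / 2))‖ ≤ ‖Ψ (1 / 2)‖ := Complex.norm_le_norm_of_mapsTo_ball hΘd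
    (hΘm.mono_right ball_subset_closedBall) hΘ0 (by simpa using hΨm h2)
  rw [hΘΨ _ h2] at hge
  have heq := le_antisymm hle hge
  have haff := Complex.affine_of_mapsTo_ball_of_norm_dslope_eq_div (R₂ := 1) hΨd
    (by rw [hΨ0]; exact hΨm.mono_right ball_subset_closedBall) h2 (by
      rw [dslope_of_ne _ (by norm_num), slope_def_field, hΨ0, sub_zero, sub_zero, norm_div, heq]
      norm_num)
  refine ⟨b, dslope Ψ 0 (1 / 2), fun z hz => ?_⟩
  have := haff hz
  simp only [hΨ0, sub_zero, zero_add, smul_eq_mul] at this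
  have hd := mob_den b (φ z) hb (by simpa using ball_subset_closedBall (hφ hz))
  simp only [Ψ, Function.comp, mob] at this
  rw [div_eq_iff hd] at this
  rw [this]; ring

end FourPt

/-- Uniqueness of internally conformal parameterizations with four matched boundary points:
if `f` and `g` are continuous injective maps of the closed unit disc, holomorphic on the open
disc, with the same image, `f 1 = g 1`, `f (-1) = g (-1)`, and there are `w_f, w_g` on the
circle distinct from `±1` with `f w_f = g w_g` and `f (-w_f) = g (-w_g)`, then `f = g` on the
closed disc. -/
theorem conformal_param_unique_four_points (f g : ℂ → ℂ)
    (hfc : ContinuousOn f unitDisc) (hfi : Set.InjOn f unitDisc)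
    (hfd : DifferentiableOn ℂ f (Metric.ball 0 1))
    (hgc : ContinuousOn g unitDisc) (hgi : Set.InjOn g unitDisc)
    (hgd : DifferentiableOn ℂ g (Metric.ball 0 1))
    (him : f '' unitDisc = g '' unitDisc)
    (h1 : f 1 = g 1) (hm1 : f (-1) = g (-1))
    (wf wg : ℂ) (hwf : wf ∈ unitCircle) (hwf1 : wf ≠ 1) (hwfm1 : wf ≠ -1)
    (hwg : wg ∈ unitCircle) (hwg1 : wg ≠ 1) (hwgm1 : wg ≠ -1)
    (he : f wf = g wg) (he' : f (-wf) = g (-wg)) :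
    Set.EqOn f g unitDisc := by
  have h1m : (1 : ℂ) ∈ closedBall (0 : ℂ) 1 := by simp
  have hm1m : (-1 : ℂ) ∈ closedBall (0 : ℂ) 1 := by simp
  have hwfm : wf ∈ closedBall (0 : ℂ) 1 := sphere_subset_closedBall hwf
  have hwgm : wg ∈ closedBall (0 : ℂ) 1 := sphere_subset_closedBall hwg
  have hwfm' : -wf ∈ closedBall (0 : ℂ) 1 := by simpa using hwfm
  have hwgm' : -wg ∈ closedBall (0 : ℂ) 1 := by simpa using hwgm
  unfold unitDisc at *
  obtain ⟨φ, hφc, hφm, hφb, hφd, hφe⟩ := FourPt.transition f g hfc hfi hfd hgc hgi hgd him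
  obtain ⟨ψ, hψc, hψm, hψb, hψd, hψe⟩ := FourPt.transition g f hgc hgi hgd hfc hfi hfd him.symm
  obtain ⟨b, c, hbc⟩ := FourPt.auto φ ψ hφb hφd hψb hψd (fun z hz => by
    have hz' := ball_subset_closedBall hz
    exact hfi (hψm (hφm hz')) hz' (by rw [hψe _ (hφm hz'), hφe _ hz']))
  have hbc' : ∀ z ∈ closedBall (0 : ℂ) 1,
      φ z - b = c * z * (1 - (starRingEnd ℂ) b * φ z) := by
    have hcl : closure (ball (0 : ℂ) 1) = closedBall 0 1 := closure_ball 0 one_ne_zero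
    have : Set.EqOn (fun z => φ z - b) (fun z => c * z * (1 - (starRingEnd ℂ) b * φ z))
        (closedBall 0 1) := by
      refine Set.EqOn.of_subset_closure (s := ball (0 : ℂ) 1) hbc ?_ ?_
        ball_subset_closedBall hcl.ge
      · fun_prop
      · fun_prop
    exact this
  have p1 : φ 1 = 1 := hgi (hφm h1m) h1m (by rw [hφe _ h1m, h1])
  have p2 : φ (-1) = -1 := hgi (hφm hm1m) hm1m (by rw [hφe _ hm1m, hm1])
  have p3 : φ wf = wg := hgi (hφm hwfm) hwgm (by rw [hφe _ hwfm, he])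
  have p4 : φ (-wf) = -wg := hgi (hφm hwfm') hwgm' (by rw [hφe _ hwfm', he'])
  have e1 := hbc' 1 h1m
  have e2 := hbc' (-1) hm1m
  have e3 := hbc' wf hwfm
  have e4 := hbc' (-wf) hwfm'
  rw [p1] at e1
  rw [p2] at e2
  rw [p3] at e3
  rw [p4] at e4
  set d := (starRingEnd ℂ) b with hd
  have hcb : b = c * d := by linear_combination (-1 / 2 : ℂ) * (e1 + e2)
  have hc : c = 1 := by linear_combination (-1 / 2 : ℂ) * (e1 - e2)
  subst hc
  rw [one_mul] at hcb
  rw [← hcb] at e3 e4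
  have hbw : b * (1 - wf * wg) = 0 := by linear_combination (-1 / 2 : ℂ) * (e3 + e4)
  have hb0 : b = 0 := by
    rcases mul_eq_zero.1 hbw with h | h
    · exact h
    · exfalso
      have hww : wg = wf := by linear_combination e3 + b * h
      rw [hww] at h
      have : (1 - wf) * (1 + wf) = 0 := by linear_combination h
      rcases mul_eq_zero.1 this with h' | h'
      · exact hwf1 (sub_eq_zero.1 h').symm
      · exact hwfm1 (by linear_combination h')
  intro z hz
  have e5 := hbc' z hz
  have hφz : φ z = z := by
    rw [← hcb, hb0] at e5
    linear_combination e5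
  rw [← hφe z hz, hφz]
end
end
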